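/- For every c ∈ (0,1] and every C₀ ≥ 1 there exists a constant C, depending only on c and C₀, such that the following holds. Let E ⊂ ℝ² be finite, let x ∈ E, let S ⊆ E, and let x₀ ∈ ℝ² satisfy dist(x₀, E) ≥ c·|x₀ − x|. If σ(x,S) ⊆ C₀·σ♯(x,16), then σ(x₀,S) ⊆ C·σ♯(x₀,16). -/

import Mathlib

open scoped Pointwise

/-- The plane `ℝ²`. -/
abbrev E2 := EuclideanSpace ℝ (Fin 2)

/-- An affine polynomial on `ℝ²`, represented by its constant term and linear
part: `P(y) = P.1 + P.2 y`. -/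
abbrev AffPoly := ℝ × (E2 →L[ℝ] ℝ)

/-- The one-jet `J_x φ` of `φ` at `x`, as an affine polynomial. -/
noncomputable def jet1 (φ : E2 → ℝ) (x : E2) : AffPoly :=
  (φ x - fderiv ℝ φ x x, fderiv ℝ φ x)

/-- `σ(x,S)`: the set of one-jets at `x` of `C²` functions vanishing on `S`
with `C²` norm at most `1`. -/
def sigmaSet (x : E2) (S : Set E2) : Set AffPoly :=
  {p | ∃ φ : E2 → ℝ, ContDiff ℝ 2 φ ∧ (∀ y ∈ S, φ y = 0) ∧
    (∀ z : E2, ∀ i : ℕ, i ≤ 2 → ‖iteratedFDeriv ℝ i φ z‖ ≤ 1) ∧ p = jet1 φ x}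

/-- `σ♯(x,k) = ⋂_{S ⊆ E, #S ≤ k} σ(x,S)`. -/
def sigmaSharp (E : Set E2) (x : E2) (k : ℕ) : Set AffPoly :=
  ⋂ (S : Set E2) (_ : S ⊆ E ∧ S.ncard ≤ k), sigmaSet x S

open scoped Topology

/-- Cutoff functions at `x₀` of scale `r`, with derivative bounds uniform in `x₀` and `r`. -/
theorem exists_cutoff : ∃ A : ℝ, 0 ≤ A ∧ ∀ (x₀ : E2) (r : ℝ), 0 < r →
    ∃ θ : E2 → ℝ, ContDiff ℝ 2 θ ∧ θ =ᶠ[𝓝 x₀] 1 ∧ (∀ y, r ≤ dist y x₀ → θ y = 0) ∧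
      (∀ i ≤ 2, ∀ y, ‖iteratedFDeriv ℝ i θ y‖ ≤ A * r⁻¹ ^ i) ∧
      ∀ i ≤ 2, ∀ y, r < dist y x₀ → iteratedFDeriv ℝ i θ y = 0 := by
  let η : ContDiffBump (0 : E2) := ⟨1 / 2, 1, by norm_num, by norm_num⟩
  have hη : ContDiff ℝ 2 η := η.contDiff
  have hbdd : ∀ i ≤ 2, ∃ K, ∀ y, ‖iteratedFDeriv ℝ i η y‖ ≤ K := fun i hi =>
    (η.hasCompactSupport.iteratedFDeriv i).exists_bound_of_continuous
      (hη.continuous_iteratedFDeriv (by exact_mod_cast hi))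
  obtain ⟨K₀, hK₀⟩ := hbdd 0 (by norm_num)
  obtain ⟨K₁, hK₁⟩ := hbdd 1 (by norm_num)
  obtain ⟨K₂, hK₂⟩ := hbdd 2 le_rfl
  refine ⟨max K₀ (max K₁ K₂), (norm_nonneg _).trans ((hK₀ 0).trans (le_max_left _ _)), ?_⟩
  have hA : ∀ i ≤ 2, ∀ y, ‖iteratedFDeriv ℝ i η y‖ ≤ max K₀ (max K₁ K₂) := by
    intro i hi y
    interval_cases i
    · exact (hK₀ y).trans (by simp)
    · exact (hK₁ y).trans (by simp)
    · exact (hK₂ y).trans (by simp)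
  intro x₀ r hr
  have hD : ∀ i ≤ 2, ∀ y, iteratedFDeriv ℝ i (fun z => η (r⁻¹ • (z - x₀))) y =
      r⁻¹ ^ i • iteratedFDeriv ℝ i η (r⁻¹ • (y - x₀)) := by
    intro i hi y
    rw [iteratedFDeriv_comp_sub (f := fun z => η (r⁻¹ • z)),
      iteratedFDeriv_comp_const_smul _ (hη.of_le (by exact_mod_cast hi))]
  have hnorm : ∀ y, ‖r⁻¹ • (y - x₀)‖ = dist y x₀ / r := by
    intro y
    rw [norm_smul, Real.norm_of_nonneg (by positivity), dist_eq_norm]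
    ring
  refine ⟨fun z => η (r⁻¹ • (z - x₀)), by fun_prop, ?_, ?_, ?_, ?_⟩
  · have ht : Filter.Tendsto (fun z : E2 => r⁻¹ • (z - x₀)) (𝓝 x₀) (𝓝 0) := by
      have : Continuous fun z : E2 => r⁻¹ • (z - x₀) := by fun_prop
      simpa using this.tendsto x₀
    exact ht.eventually η.eventuallyEq_one
  · intro y hy
    refine η.zero_of_le_dist ?_
    rw [dist_zero_right, hnorm]
    exact (one_le_div hr).2 hy
  · intro i hi y
    rw [hD i hi, norm_smul, norm_pow, Real.norm_of_nonneg (by positivity), mul_comm]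
    gcongr
    exact hA i hi _
  · intro i hi y hy
    rw [hD i hi]
    have : iteratedFDeriv ℝ i η (r⁻¹ • (y - x₀)) = 0 := by
      by_contra hne
      have := support_iteratedFDeriv_subset (𝕜 := ℝ) i (Function.mem_support.2 hne)
      rw [η.tsupport_eq, mem_closedBall_zero_iff, hnorm, div_le_one hr] at this
      linarith
    rw [this, smul_zero]

theorem norm_fderiv_le_of_fderiv_eq_zero {d : E2 → ℝ} (hd : ContDiff ℝ 2 d) {M : ℝ}
    (hM : ∀ y, ‖iteratedFDeriv ℝ 2 d y‖ ≤ M) {x : E2} (hx : fderiv ℝ d x = 0) (y : E2) :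
    ‖fderiv ℝ d y‖ ≤ M * dist y x := by
  have hd' : ContDiff ℝ 1 (fderiv ℝ d) := hd.fderiv_right (by norm_num)
  have := convex_univ.norm_image_sub_le_of_norm_fderiv_le (f := fderiv ℝ d) (C := M)
    (fun z _ => hd'.differentiable (by norm_num) z) (fun z _ => ?_)
    (Set.mem_univ x) (Set.mem_univ y)
  · simpa [hx, dist_eq_norm] using this
  · rw [← norm_iteratedFDeriv_one, norm_iteratedFDeriv_fderiv]
    exact hM z

theorem norm_le_of_jet_eq_zero {d : E2 → ℝ} (hd : ContDiff ℝ 2 d) {M : ℝ}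
    (hM : ∀ y, ‖iteratedFDeriv ℝ 2 d y‖ ≤ M) {x : E2} (h0 : d x = 0)
    (hx : fderiv ℝ d x = 0) (y : E2) : ‖d y‖ ≤ M * dist y x ^ 2 := by
  have hM0 : 0 ≤ M := (norm_nonneg _).trans (hM x)
  have := (convex_closedBall x (dist y x)).norm_image_sub_le_of_norm_fderiv_le (f := d)
    (C := M * dist y x) (fun z _ => hd.differentiable (by norm_num) z) (fun z hz => ?_)
    (Metric.mem_closedBall_self dist_nonneg) (Metric.mem_closedBall.2 le_rfl)
  · simpa [h0, dist_eq_norm, pow_two, mul_assoc] using this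
  · refine (norm_fderiv_le_of_fderiv_eq_zero hd hM hx z).trans ?_
    gcongr
    exact hz

/-- Taylor bounds near `x`, capped at unit scale. -/
theorem norm_iteratedFDeriv_le_of_jet_eq_zero {d : E2 → ℝ} (hd : ContDiff ℝ 2 d) {M : ℝ}
    (hM : ∀ y, ∀ i ≤ 2, ‖iteratedFDeriv ℝ i d y‖ ≤ M) {x : E2} (h0 : d x = 0)
    (hx : fderiv ℝ d x = 0) {δ : ℝ} (hδ : 0 < δ) {y : E2} (hy : dist y x ≤ 2 * δ)
    {i : ℕ} (hi : i ≤ 2) : ‖iteratedFDeriv ℝ i d y‖ ≤ 4 * M * min 1 δ ^ (2 - i) := by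
  have hM0 : 0 ≤ M := (norm_nonneg _).trans (hM x 0 (by norm_num))
  have hM2 : ∀ y, ‖iteratedFDeriv ℝ 2 d y‖ ≤ M := fun y => hM y 2 le_rfl
  rcases le_total 1 δ with h | h
  · rw [min_eq_left h, one_pow]
    linarith [hM y i hi]
  · rw [min_eq_right h]
    interval_cases i
    · rw [norm_iteratedFDeriv_zero]
      calc ‖d y‖ ≤ M * dist y x ^ 2 := norm_le_of_jet_eq_zero hd hM2 h0 hx y
        _ ≤ M * (2 * δ) ^ 2 := by gcongr
        _ = 4 * M * δ ^ (2 - 0) := by ring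
    · rw [norm_iteratedFDeriv_one]
      calc ‖fderiv ℝ d y‖ ≤ M * dist y x := norm_fderiv_le_of_fderiv_eq_zero hd hM2 hx y
        _ ≤ M * (2 * δ) := by gcongr
        _ ≤ 4 * M * δ ^ (2 - 1) := by
          norm_num
          nlinarith [mul_nonneg hM0 hδ.le]
    · simpa using (hM2 y).trans (by linarith)

/-- A function with vanishing jet at `x` can be localised near `x₀`, away from `E`, keeping
its jet at `x₀` and its `C²` norm under control. -/
theorem exists_localization {c : ℝ} (hc : 0 < c) (hc1 : c ≤ 1) : ∃ K : ℝ, 0 ≤ K ∧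
    ∀ (E : Set E2) (x x₀ : E2), (∀ y ∈ E, c * dist x₀ x ≤ dist x₀ y) →
      ∀ (d : E2 → ℝ) (M : ℝ), ContDiff ℝ 2 d → (∀ y, ∀ i ≤ 2, ‖iteratedFDeriv ℝ i d y‖ ≤ M) →
        d x = 0 → fderiv ℝ d x = 0 →
        ∃ g : E2 → ℝ, ContDiff ℝ 2 g ∧ (∀ y ∈ E, g y = 0) ∧ g x₀ = d x₀ ∧
          fderiv ℝ g x₀ = fderiv ℝ d x₀ ∧ ∀ y, ∀ i ≤ 2, ‖iteratedFDeriv ℝ i g y‖ ≤ K * M := by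
  obtain ⟨A, hA, hcut⟩ := exists_cutoff
  refine ⟨16 * A * c⁻¹ ^ 2, by positivity, fun E x x₀ hE d M hd hM h0 hx => ?_⟩
  have hM0 : 0 ≤ M := (norm_nonneg _).trans (hM x 0 (by norm_num))
  rcases eq_or_ne x₀ x with rfl | hne
  · refine ⟨fun _ => 0, contDiff_const, by simp, h0.symm, by simp [hx], fun y i _ => ?_⟩
    have : iteratedFDeriv ℝ i (fun _ : E2 => (0 : ℝ)) = 0 := iteratedFDeriv_fun_zero
    rw [this]
    simpa using by positivity
  set δ := dist x₀ x with hδdef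
  have hδ : 0 < δ := dist_pos.2 hne
  set m := min 1 δ with hm
  have hm0 : 0 < m := lt_min one_pos hδ
  have hm1 : m ≤ 1 := min_le_left _ _
  have hmδ : m ≤ δ := min_le_right _ _
  obtain ⟨θ, hθ, hθ1, hθ0, hθb, hθs⟩ := hcut x₀ (c * m) (by positivity)
  have heq : (fun y => θ y * d y) =ᶠ[𝓝 x₀] d := by
    filter_upwards [hθ1] with y hy
    simp [hy]
  refine ⟨fun y => θ y * d y, hθ.mul hd, fun y hy => ?_, heq.eq_of_nhds, heq.fderiv_eq,
    fun y i hi => ?_⟩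
  · have hθy : θ y = 0 := hθ0 y (dist_comm x₀ y ▸ le_trans (by gcongr) (hE y hy))
    simp [hθy]
  · refine (norm_iteratedFDeriv_mul_le hθ hd y (by exact_mod_cast hi)).trans ?_
    have hterm : ∀ j ∈ Finset.range (i + 1),
        (i.choose j : ℝ) * ‖iteratedFDeriv ℝ j θ y‖ * ‖iteratedFDeriv ℝ (i - j) d y‖ ≤
          i.choose j * (4 * A * c⁻¹ ^ 2 * M) := by
      intro j hj
      have hji : j ≤ i := Nat.lt_succ_iff.1 (Finset.mem_range.1 hj)
      rw [mul_assoc]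
      refine mul_le_mul_of_nonneg_left ?_ (Nat.cast_nonneg _)
      rcases lt_or_ge (c * m) (dist y x₀) with hfar | hnear
      · rw [hθs j (hji.trans hi) y hfar, norm_zero, zero_mul]
        positivity
      have hyx : dist y x ≤ 2 * δ := by
        have : c * m ≤ δ := (mul_le_of_le_one_left hm0.le hc1).trans hmδ
        linarith [dist_triangle y x₀ x]
      have hpow : m⁻¹ ^ j * m ^ (2 - (i - j)) ≤ 1 := by
        rw [show 2 - (i - j) = j + (2 - i) by omega, pow_add, ← mul_assoc, ← mul_pow,
          inv_mul_cancel₀ hm0.ne', one_pow, one_mul]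
        exact pow_le_one₀ hm0.le hm1
      have hcpow : c⁻¹ ^ j ≤ c⁻¹ ^ 2 :=
        pow_le_pow_right₀ ((one_le_inv₀ hc).2 hc1) (hji.trans hi)
      calc ‖iteratedFDeriv ℝ j θ y‖ * ‖iteratedFDeriv ℝ (i - j) d y‖
          ≤ (A * (c * m)⁻¹ ^ j) * (4 * M * m ^ (2 - (i - j))) := by
            gcongr
            · exact hθb j (hji.trans hi) y
            · exact norm_iteratedFDeriv_le_of_jet_eq_zero hd hM h0 hx hδ hyx (by omega)
        _ = 4 * A * c⁻¹ ^ j * M * (m⁻¹ ^ j * m ^ (2 - (i - j))) := by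
            rw [mul_inv, mul_pow]
            ring
        _ ≤ 4 * A * c⁻¹ ^ j * M * 1 := by gcongr
        _ ≤ 4 * A * c⁻¹ ^ 2 * M := by
            rw [mul_one]
            gcongr
    refine (Finset.sum_le_sum hterm).trans ?_
    have hsum : ∑ j ∈ Finset.range (i + 1), (i.choose j : ℝ) = 2 ^ i := by
      exact_mod_cast Nat.sum_range_choose i
    have h4 : (2 : ℝ) ^ i ≤ 2 ^ 2 := pow_le_pow_right₀ (by norm_num) hi
    rw [← Finset.sum_mul, hsum]
    calc (2 : ℝ) ^ i * (4 * A * c⁻¹ ^ 2 * M) ≤ 2 ^ 2 * (4 * A * c⁻¹ ^ 2 * M) := by gcongr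
      _ = 16 * A * c⁻¹ ^ 2 * M := by ring

theorem jet1_const_smul {φ : E2 → ℝ} {x : E2} (hφ : DifferentiableAt ℝ φ x) (a : ℝ) :
    jet1 (a • φ) x = a • jet1 φ x := by
  simp [jet1, fderiv_const_smul hφ, mul_sub]

theorem jet1_eq_iff {φ ψ : E2 → ℝ} {x : E2} :
    jet1 φ x = jet1 ψ x ↔ φ x = ψ x ∧ fderiv ℝ φ x = fderiv ℝ ψ x := by
  simp only [jet1, Prod.mk.injEq]
  constructor
  · rintro ⟨h1, h2⟩
    rw [h2] at h1
    exact ⟨by linarith, h2⟩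
  · rintro ⟨h1, h2⟩
    rw [h1, h2]
    exact ⟨rfl, rfl⟩

theorem norm_iteratedFDeriv_const_smul_le {φ : E2 → ℝ} (hφ : ContDiff ℝ 2 φ) {M a : ℝ}
    (ha : 0 ≤ a) {y : E2} {i : ℕ} (hi : i ≤ 2) (hM : ‖iteratedFDeriv ℝ i φ y‖ ≤ M) :
    ‖iteratedFDeriv ℝ i (a • φ) y‖ ≤ a * M := by
  rw [iteratedFDeriv_const_smul_apply (hφ.of_le (by exact_mod_cast hi)).contDiffAt, norm_smul,
    Real.norm_of_nonneg ha]
  gcongr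

/-- Transferring the `σ`-inclusion from a point `x ∈ E` to a
nearby point `x₀` that is quantitatively far from `E`. -/
theorem statement13 :
    ∀ c : ℝ, 0 < c → c ≤ 1 → ∀ C₀ : ℝ, 1 ≤ C₀ →
      ∃ C : ℝ, 0 < C ∧
        ∀ E : Set E2, E.Finite → ∀ x ∈ E, ∀ S ⊆ E, ∀ x₀ : E2,
          (∀ y ∈ E, c * dist x₀ x ≤ dist x₀ y) →
          sigmaSet x S ⊆ C₀ • sigmaSharp E x 16 →
          sigmaSet x₀ S ⊆ C • sigmaSharp E x₀ 16 := by
  intro c hc hc1 C₀ hC₀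
  obtain ⟨K, hK, hloc⟩ := exists_localization hc hc1
  have hC : 0 < C₀ + K * (1 + C₀) := by positivity
  refine ⟨C₀ + K * (1 + C₀), hC, ?_⟩
  rintro E - x - S - x₀ hE hincl _ ⟨φ, hφ, hφS, hφb, rfl⟩
  rw [Set.mem_smul_set_iff_inv_smul_mem₀ hC.ne']
  obtain ⟨q, hq, hqφ⟩ := hincl ⟨φ, hφ, hφS, hφb, rfl⟩
  refine Set.mem_iInter₂.2 fun S' hS' => ?_
  obtain ⟨ψ, hψ, hψS, hψb, rfl⟩ := Set.mem_iInter₂.1 hq S' hS'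
  have hψ' : ContDiff ℝ 2 (C₀ • ψ) := contDiff_const.smul hψ
  have hψ'b : ∀ y, ∀ i ≤ 2, ‖iteratedFDeriv ℝ i (C₀ • ψ) y‖ ≤ C₀ := fun y i hi => by
    simpa using norm_iteratedFDeriv_const_smul_le hψ (by linarith) hi (hψb y i hi)
  have hdiff : ∀ {f : E2 → ℝ}, ContDiff ℝ 2 f → ∀ y, DifferentiableAt ℝ f y :=
    fun hf y => hf.differentiable (by norm_num) y
  have hjet : jet1 (C₀ • ψ) x = jet1 φ x := (jet1_const_smul (hdiff hψ x) C₀).trans hqφ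
  obtain ⟨hval, hder⟩ := jet1_eq_iff.1 hjet
  obtain ⟨g, hg, hgE, hgval, hgder, hgb⟩ := hloc E x x₀ hE (φ - C₀ • ψ) (1 + C₀) (hφ.sub hψ')
    (fun y i hi => by
      have hi' : (i : WithTop ℕ∞) ≤ 2 := by exact_mod_cast hi
      rw [iteratedFDeriv_sub_apply (hφ.of_le hi').contDiffAt (hψ'.of_le hi').contDiffAt]
      exact (norm_sub_le _ _).trans (add_le_add (hφb y i hi) (hψ'b y i hi)))
    (by rw [Pi.sub_apply, hval, sub_self])
    (by rw [fderiv_sub (hdiff hφ x) (hdiff hψ' x), hder, sub_self])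
  have hf : ContDiff ℝ 2 (C₀ • ψ + g) := hψ'.add hg
  refine ⟨(C₀ + K * (1 + C₀))⁻¹ • (C₀ • ψ + g), contDiff_const.smul hf, fun y hy => ?_,
    fun y i hi => ?_, ?_⟩
  · simp [hψS y hy, hgE y (hS'.1 hy)]
  · refine (norm_iteratedFDeriv_const_smul_le hf (inv_nonneg.2 hC.le) hi ?_).trans_eq
      (inv_mul_cancel₀ hC.ne')
    have hi' : (i : WithTop ℕ∞) ≤ 2 := by exact_mod_cast hi
    rw [iteratedFDeriv_add_apply (hψ'.of_le hi').contDiffAt (hg.of_le hi').contDiffAt]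
    exact (norm_add_le _ _).trans (add_le_add (hψ'b y i hi) (hgb y i hi))
  · rw [jet1_const_smul (hdiff hf x₀)]
    congr 1
    refine jet1_eq_iff.2 ⟨?_, ?_⟩
    · rw [Pi.add_apply, hgval, Pi.sub_apply]
      ring
    · rw [fderiv_add (hdiff hψ' x₀) (hdiff hg x₀), hgder, fderiv_sub (hdiff hφ x₀) (hdiff hψ' x₀)]
      abel
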